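/- (Theorem 1, pairwise stability) Let K be a step at which no rejection occurs (for all v ∈ V and s ∈ M, s ∈ Cv v (A v K) implies v ∈ Cs s (P s K)), and define the output matching by μV v = Cv v (A v K) for each video v and μM s = Cs s (P s K) for each station s. Then the matching is pairwise stable: there is no pair (v, s) with s ∉ μV v such that both s ∈ Cv v (μV v ∪ {s}) and v ∈ Cs s (μM s ∪ {v}). -/

import Mathlib

universe u

/-- A choice function on a finite type `α`: selects a subset of each finite set,
satisfying substitutability and irrelevance of rejected alternatives (IRC). -/
structure ChoiceFun (α : Type u) [Fintype α] [DecidableEq α] where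
  C : Finset α → Finset α
  choice_subset : ∀ S : Finset α, C S ⊆ S
  substitutable : ∀ {x : α} {S T : Finset α}, x ∈ C S → x ∈ T → T ⊆ S → x ∈ C T
  irc : ∀ {S T : Finset α}, C T ⊆ S → S ⊆ T → C S = C T

variable {M V : Type u} [Fintype M] [DecidableEq M] [Fintype V] [DecidableEq V]

/-- Proposal set of station `s` given current offer sets `A`:
the videos `v` that propose to `s`, i.e. with `s ∈ Cv v (A v)`. -/
def propSet (Cv : V → ChoiceFun M) (A : V → Finset M) (s : M) : Finset V :=
  Finset.univ.filter fun v => s ∈ (Cv v).C (A v)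

/-- Offer sets of the deferred-acceptance algorithm: `offers Cv Cs k v = A v k`. -/
def offers (Cv : V → ChoiceFun M) (Cs : M → ChoiceFun V) : ℕ → V → Finset M
  | 0 => fun _ => Finset.univ
  | k + 1 => fun v =>
      offers Cv Cs k v \
        (Finset.univ.filter fun s =>
          s ∈ (Cv v).C (offers Cv Cs k v) ∧
            v ∉ (Cs s).C (propSet Cv (offers Cv Cs k) s))

/-- Proposal set of station `s` at step `k`: `proposals Cv Cs k s = P s k`. -/
def proposals (Cv : V → ChoiceFun M) (Cs : M → ChoiceFun V) (k : ℕ) (s : M) : Finset V :=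
  propSet Cv (offers Cv Cs k) s

/-- Station `s` rejects video `v` at step `k`. -/
def rejects (Cv : V → ChoiceFun M) (Cs : M → ChoiceFun V) (k : ℕ) (s : M) (v : V) : Prop :=
  s ∈ (Cv v).C (offers Cv Cs k v) ∧ v ∉ (Cs s).C (proposals Cv Cs k s)

/-- An alternative rejected from `insert x P` is also rejected from `insert x Q`, as soon as `Q`
retains everything chosen from `P`. -/
theorem ChoiceFun.notMem_insert_of_choice_subset {α : Type u} [Fintype α] [DecidableEq α]
    (c : ChoiceFun α) {x : α} {P Q : Finset α} (hx : x ∉ c.C (insert x P)) (hPQ : c.C P ⊆ Q) :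
    x ∉ c.C (insert x Q) := by
  have hsub : c.C (insert x P) ⊆ P := fun y hy =>
    Finset.mem_of_mem_insert_of_ne (c.choice_subset _ hy) (by rintro rfl; exact hx hy)
  have hP : c.C P = c.C (insert x P) := c.irc hsub (Finset.subset_insert x P)
  have hins : c.C (insert x (c.C P)) = c.C (insert x P) :=
    c.irc (hP ▸ Finset.subset_insert x _) (Finset.insert_subset_insert x (c.choice_subset P))
  intro hxQ
  exact hx (hins ▸ c.substitutable hxQ (Finset.mem_insert_self x _)
    (Finset.insert_subset_insert x hPQ))

theorem mem_proposals {Cv : V → ChoiceFun M} {Cs : M → ChoiceFun V} {k : ℕ} {s : M} {v : V} :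
    v ∈ proposals Cv Cs k s ↔ s ∈ (Cv v).C (offers Cv Cs k v) := by
  simp [proposals, propSet]

theorem mem_offers_succ {Cv : V → ChoiceFun M} {Cs : M → ChoiceFun V} {k : ℕ} {s : M} {v : V} :
    s ∈ offers Cv Cs (k + 1) v ↔ s ∈ offers Cv Cs k v ∧ ¬ rejects Cv Cs k s v := by
  simp [offers, rejects, proposals]

/-- A video held by a station proposes to it again at the next step. -/
theorem choice_proposals_subset_succ (Cv : V → ChoiceFun M) (Cs : M → ChoiceFun V) (k : ℕ)
    (s : M) : (Cs s).C (proposals Cv Cs k s) ⊆ proposals Cv Cs (k + 1) s := by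
  intro w hw
  have hprop := mem_proposals.1 ((Cs s).choice_subset _ hw)
  exact mem_proposals.2 ((Cv w).substitutable hprop
    (mem_offers_succ.2 ⟨(Cv w).choice_subset _ hprop, fun h => h.2 hw⟩)
    fun _ ht => (mem_offers_succ.1 ht).1)

/-- A video rejected by a station in the past would still be rejected if it proposed again. -/
theorem notMem_choice_insert_proposals (Cv : V → ChoiceFun M) (Cs : M → ChoiceFun V) {k : ℕ}
    {s : M} {v : V} (hs : s ∉ offers Cv Cs k v) :
    v ∉ (Cs s).C (insert v (proposals Cv Cs k s)) := by
  induction k with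
  | zero => exact absurd (Finset.mem_univ s) hs
  | succ k ih =>
    refine (Cs s).notMem_insert_of_choice_subset ?_ (choice_proposals_subset_succ Cv Cs k s)
    by_cases hk : s ∈ offers Cv Cs k v
    · have hrej : rejects Cv Cs k s v := by
        by_contra h
        exact hs (mem_offers_succ.2 ⟨hk, h⟩)
      rw [Finset.insert_eq_of_mem (mem_proposals.2 hrej.1)]
      exact hrej.2
    · exact ih hk

/-- **Theorem 1 (pairwise stability).** If no rejection occurs at step `K`, then the matching
`μV v = Cv v (A v K)`, `μM s = Cs s (P s K)` is pairwise stable: no pair `(v, s)` with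
`s ∉ μV v` satisfies both `s ∈ Cv v (μV v ∪ {s})` and `v ∈ Cs s (μM s ∪ {v})`. -/
theorem pairwise_stable (Cv : V → ChoiceFun M) (Cs : M → ChoiceFun V) (K : ℕ)
    (hno : ∀ (v : V) (s : M),
      s ∈ (Cv v).C (offers Cv Cs K v) → v ∈ (Cs s).C (proposals Cv Cs K s)) :
    ¬ ∃ (v : V) (s : M),
        s ∉ (Cv v).C (offers Cv Cs K v) ∧
        s ∈ (Cv v).C ((Cv v).C (offers Cv Cs K v) ∪ {s}) ∧
        v ∈ (Cs s).C ((Cs s).C (proposals Cv Cs K s) ∪ {v}) := by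
  rintro ⟨v, s, hs, hv, hvs⟩
  by_cases hA : s ∈ offers Cv Cs K v
  · have hirc := (Cv v).irc (Finset.subset_union_left (s₂ := {s}))
      (Finset.union_subset ((Cv v).choice_subset _) (Finset.singleton_subset_iff.2 hA))
    exact hs (hirc ▸ hv)
  · have hheld : (Cs s).C (proposals Cv Cs K s) = proposals Cv Cs K s :=
      ((Cs s).choice_subset _).antisymm fun w hw => hno w s (mem_proposals.1 hw)
    rw [hheld, Finset.union_comm, ← Finset.insert_eq] at hvs
    exact notMem_choice_insert_proposals Cv Cs hA hvs
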